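/- arXiv:1802.09118 — 2 statements merged into one kernel-verified Lean document; each statement's English description precedes it below -/
import Mathlib

section
/- Let (f, w, p) be a processed-flow solution and let v_0, …, v_{k−1} (k ≥ 2) be pairwise distinct vertices such that f(v_j, v_{j+1 mod k}) − w(v_j, v_{j+1 mod k}) > 0 for every j. Let m := min_j (f(v_j, v_{j+1 mod k}) − w(v_j, v_{j+1 mod k})), and define f' by subtracting m from f on each cycle edge (v_j, v_{j+1 mod k}) and leaving f unchanged on all other pairs. Then (f', w, p) is again a processed-flow solution, and the net source flow is unchanged: Σ_u f'(s,u) − Σ_u f'(u,s) = Σ_u f(s,u) − Σ_u f(u,s). -/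
open Finset

/-- A processed-flow solution on a finite vertex set `V` with source `s`, sink `t`,
edge capacities `B` and vertex processing capacities `C`. -/
def IsPFS {V : Type*} [Fintype V] (s t : V) (B : V → V → ℝ) (C : V → ℝ)
    (f w : V → V → ℝ) (p : V → ℝ) : Prop :=
  (∀ u v, 0 ≤ w u v ∧ w u v ≤ f u v ∧ f u v ≤ B u v) ∧
  (∀ v, v ≠ s → v ≠ t → ∑ u, f u v = ∑ u, f v u) ∧
  (∀ v, v ≠ s → p v = ∑ u, w u v - ∑ u, w v u) ∧
  (∀ v, 0 ≤ p v ∧ p v ≤ C v) ∧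
  (∀ u, w s u = f s u) ∧
  (∀ u, w u t = 0)

theorem sum_range_add_one_mod {M : Type*} [AddCommMonoid M] (g : ℕ → M) (k : ℕ) :
    ∑ j ∈ range k, g ((j + 1) % k) = ∑ j ∈ range k, g j := by
  cases k with
  | zero => simp
  | succ n =>
    rw [sum_range_succ, sum_range_succ', Nat.mod_self]
    congr 1
    refine sum_congr rfl fun j hj => ?_
    rw [Nat.mod_eq_of_lt (by simpa using hj)]

open Classical in
/-- The circulation sending `m` units along the closed walk `v 0, …, v (k - 1), v 0`. -/
noncomputable def cycleFlow {V : Type*} (v : ℕ → V) (k : ℕ) (m : ℝ) (a b : V) : ℝ :=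
  ∑ j ∈ range k, if a = v j ∧ b = v ((j + 1) % k) then m else 0

theorem cycleFlow_edge {V : Type*} {v : ℕ → V} {k : ℕ} (m : ℝ)
    (hinj : ∀ i < k, ∀ j < k, v i = v j → i = j) {j : ℕ} (hj : j < k) :
    cycleFlow v k m (v j) (v ((j + 1) % k)) = m := by
  rw [cycleFlow, sum_eq_single_of_mem j (by simpa using hj)]
  · simp
  · intro i hi hij
    rw [if_neg]
    rintro ⟨h, -⟩
    exact hij (hinj j hj i (by simpa using hi) h).symm

theorem cycleFlow_of_not_edge {V : Type*} {v : ℕ → V} {k : ℕ} (m : ℝ) {a b : V}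
    (h : ∀ j < k, ¬(a = v j ∧ b = v ((j + 1) % k))) : cycleFlow v k m a b = 0 :=
  sum_eq_zero fun j hj => if_neg (h j (by simpa using hj))

theorem sum_cycleFlow_comm {V : Type*} [Fintype V] (v : ℕ → V) (k : ℕ) (m : ℝ) (x : V) :
    ∑ u, cycleFlow v k m u x = ∑ u, cycleFlow v k m x u := by
  classical
  simp only [cycleFlow]
  rw [sum_comm, sum_comm (s := univ)]
  simp only [ite_and, sum_ite_eq', mem_univ, if_true, sum_ite_irrel, sum_const_zero]
  exact sum_range_add_one_mod (fun j => if x = v j then m else 0) k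

theorem stmt3 {V : Type*} [Fintype V]
    (s t : V) (hst : s ≠ t) (B : V → V → ℝ) (C : V → ℝ)
    (hB : ∀ u v, 0 ≤ B u v) (hC : ∀ v, 0 ≤ C v)
    (f w : V → V → ℝ) (p : V → ℝ)
    (hsol : IsPFS s t B C f w p)
    -- a cycle `v 0, v 1, …, v (k-1)` of pairwise distinct vertices (`k ≥ 2`)
    (k : ℕ) (hk : 2 ≤ k) (v : ℕ → V)
    (hinj : ∀ i < k, ∀ j < k, v i = v j → i = j)
    -- every cycle edge carries positive processed flow `f - w`
    (hpos : ∀ j < k,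
      0 < f (v j) (v ((j + 1) % k)) - w (v j) (v ((j + 1) % k)))
    -- `m` is the minimum of `f - w` over the cycle edges
    (m : ℝ)
    (hm₁ : ∀ j < k, m ≤ f (v j) (v ((j + 1) % k)) - w (v j) (v ((j + 1) % k)))
    (hm₂ : ∃ j < k, m = f (v j) (v ((j + 1) % k)) - w (v j) (v ((j + 1) % k)))
    -- `f'` subtracts `m` from `f` on each cycle edge
    (f' : V → V → ℝ)
    (hf'c : ∀ j < k, f' (v j) (v ((j + 1) % k)) = f (v j) (v ((j + 1) % k)) - m)
    -- and leaves `f` unchanged on all other ordered pairs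
    (hf'o : ∀ u u', (∀ j < k, ¬(u = v j ∧ u' = v ((j + 1) % k))) → f' u u' = f u u') :
    IsPFS s t B C f' w p ∧
      (∑ u, f' s u - ∑ u, f' u s = ∑ u, f s u - ∑ u, f u s) := by
  obtain ⟨hcap, hcons, hproc, hp, hs, ht⟩ := hsol
  have hm : 0 ≤ m := by
    obtain ⟨j, hj, rfl⟩ := hm₂
    exact (hpos j hj).le
  have hsv : ∀ j < k, s ≠ v j := by
    rintro j hj rfl
    have := hpos j hj
    rw [hs] at this
    linarith
  have hf' : ∀ a b, f' a b = f a b - cycleFlow v k m a b := by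
    intro a b
    by_cases h : ∃ j < k, a = v j ∧ b = v ((j + 1) % k)
    · obtain ⟨j, hj, rfl, rfl⟩ := h
      rw [hf'c j hj, cycleFlow_edge m hinj hj]
    · push Not at h
      have h' : ∀ j < k, ¬(a = v j ∧ b = v ((j + 1) % k)) := fun j hj hab => h j hj hab.1 hab.2
      rw [hf'o a b h', cycleFlow_of_not_edge m h', sub_zero]
  refine ⟨⟨fun a b => ⟨(hcap a b).1, ?_⟩, fun x hxs hxt => ?_, hproc, hp, fun u => ?_, ht⟩, ?_⟩
  · obtain ⟨-, hwf, hfB⟩ := hcap a b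
    by_cases h : ∃ j < k, a = v j ∧ b = v ((j + 1) % k)
    · obtain ⟨j, hj, rfl, rfl⟩ := h
      have := hm₁ j hj
      rw [hf'c j hj]
      constructor <;> linarith
    · push Not at h
      rw [hf'o a b fun j hj hab => h j hj hab.1 hab.2]
      exact ⟨hwf, hfB⟩
  · simp only [hf', sum_sub_distrib, hcons x hxs hxt, sum_cycleFlow_comm]
  · rw [hf'o s u fun j hj h => hsv j hj h.1, hs]
  · simp only [hf', sum_sub_distrib, sum_cycleFlow_comm]
    ring
end

section
/- Let (f, w, p) be a processed-flow solution with f(u,s) = 0 for every u ∈ V, and suppose there is no cyclic sequence of pairwise distinct vertices v_0, …, v_{k−1} (k ≥ 2) with f(v_j, v_{j+1 mod k}) − w(v_j, v_{j+1 mod k}) > 0 for all j. Then for every vertex v ∉ {s,t} with p(v) > 0, there exists a walk from v to t with pairwise distinct entries such that every edge (x,y) of the walk satisfies f(x,y) − w(x,y) > 0. -/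
open Finset

/-- If `r`-reachability holds from `a` to `b`, there is a duplicate-free `r`-chain from `a` to `b`. -/
lemma exists_nodup_isChain_of_reflTransGen {α : Type*} {r : α → α → Prop} {a b : α}
    (h : Relation.ReflTransGen r a b) :
    ∃ l : List α, l.head? = some a ∧ l.getLast? = some b ∧ l.Nodup ∧ l.IsChain r := by
  induction h using Relation.ReflTransGen.head_induction_on with
  | refl => exact ⟨[b], by simp⟩
  | @head a c hac _ ih =>
    obtain ⟨l, hhead, hlast, hnodup, hchain⟩ := ih
    by_cases ha : a ∈ l
    · obtain ⟨l₁, l₂, rfl⟩ := List.append_of_mem ha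
      refine ⟨a :: l₂, rfl, ?_, hnodup.of_append_right, hchain.right_of_append⟩
      simpa [List.getLast?_append] using hlast
    · refine ⟨a :: l, rfl, ?_, List.nodup_cons.2 ⟨ha, hnodup⟩, ?_⟩
      · simp [List.getLast?_cons, hlast]
      · refine List.isChain_cons.2 ⟨fun y hy => ?_, hchain⟩
        rw [hhead] at hy
        obtain rfl : c = y := by simpa using hy
        exact hac

/-- Consecutive entries of an `r`-chain are related by `r`. -/
lemma List.IsChain.rel_of_mem_zip_tail {α : Type*} {r : α → α → Prop} {l : List α}
    (h : l.IsChain r) : ∀ e ∈ l.zip l.tail, r e.1 e.2 := by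
  induction h with
  | nil => simp
  | singleton => simp
  | cons_cons hab _ ih =>
    intro e he
    rcases List.mem_cons.1 he with rfl | he
    · exact hab
    · exact ih e he

/-- The total net outflow of a set that no positive edge leaves is nonpositive. -/
lemma sum_net_outflow_nonpos {V : Type*} [Fintype V] {g : V → V → ℝ}
    (hg : ∀ u v, 0 ≤ g u v) {R : Finset V} (hR : ∀ v ∈ R, ∀ u, 0 < g v u → u ∈ R) :
    ∑ v ∈ R, (∑ u, g v u - ∑ u, g u v) ≤ 0 := by
  have hout : ∑ v ∈ R, ∑ u, g v u = ∑ v ∈ R, ∑ u ∈ R, g v u :=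
    Finset.sum_congr rfl fun v hv => Eq.symm <|
      Finset.sum_subset (Finset.subset_univ R) fun u _ hu =>
        le_antisymm (not_lt.1 fun hpos => hu (hR v hv u hpos)) (hg v u)
  have hin : ∑ v ∈ R, ∑ u ∈ R, g v u ≤ ∑ v ∈ R, ∑ u, g u v := by
    rw [Finset.sum_comm]
    exact Finset.sum_le_sum fun v _ =>
      Finset.sum_le_sum_of_subset_of_nonneg (Finset.subset_univ R) fun u _ _ => hg u v
  rw [Finset.sum_sub_distrib, hout]
  linarith

theorem stmt5 {V : Type*} [Fintype V]
    (s t : V) (hst : s ≠ t) (B : V → V → ℝ) (C : V → ℝ)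
    (hB : ∀ u v, 0 ≤ B u v) (hC : ∀ v, 0 ≤ C v)
    (f w : V → V → ℝ) (p : V → ℝ)
    (hsol : IsPFS s t B C f w p)
    (hins : ∀ u, f u s = 0)
    -- there is no cyclic sequence of pairwise distinct vertices with `f - w > 0` on each edge
    (hnocyc : ¬ ∃ (k : ℕ) (v : ℕ → V), 2 ≤ k ∧
      (∀ i < k, ∀ j < k, v i = v j → i = j) ∧
      (∀ j < k, 0 < f (v j) (v ((j + 1) % k)) - w (v j) (v ((j + 1) % k)))) :
    ∀ x, x ≠ s → x ≠ t → 0 < p x →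
      ∃ π : List V, 2 ≤ π.length ∧ π.head? = some x ∧ π.getLast? = some t ∧
        π.Nodup ∧ ∀ e ∈ π.zip π.tail, 0 < f e.1 e.2 - w e.1 e.2 := by
  classical
  obtain ⟨hcap, hcons, hproc, hp, -, -⟩ := hsol
  intro x hxs hxt hpx
  let r : V → V → Prop := fun u v => 0 < f u v - w u v
  have hreach : Relation.ReflTransGen r x t := by
    by_contra hnot
    let R : Finset V := Finset.univ.filter (Relation.ReflTransGen r x)
    have hmem : ∀ v, v ∈ R ↔ Relation.ReflTransGen r x v := fun v => by simp [R]
    have hs : ∀ v ∈ R, v ≠ s := by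
      rintro v hv rfl
      rcases Relation.ReflTransGen.cases_tail ((hmem v).1 hv) with h | ⟨u, -, hu⟩
      · exact hxs h.symm
      · have hpos : 0 < f u v - w u v := hu
        linarith [hins u, (hcap u v).1]
    have ht : ∀ v ∈ R, v ≠ t := by
      rintro v hv rfl
      exact hnot ((hmem v).1 hv)
    have hnonpos := sum_net_outflow_nonpos (g := fun u v => f u v - w u v)
      (fun u v => sub_nonneg.2 (hcap u v).2.1) (R := R)
      fun v hv u hvu => (hmem u).2 (((hmem v).1 hv).tail hvu)
    have hnet : ∑ v ∈ R, (∑ u, (f v u - w v u) - ∑ u, (f u v - w u v)) = ∑ v ∈ R, p v :=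
      Finset.sum_congr rfl fun v hv => by
        rw [Finset.sum_sub_distrib, Finset.sum_sub_distrib, hproc v (hs v hv),
          hcons v (hs v hv) (ht v hv)]
        ring
    have hpos : 0 < ∑ v ∈ R, p v :=
      Finset.sum_pos' (fun v _ => (hp v).1) ⟨x, (hmem x).2 .refl, hpx⟩
    linarith
  obtain ⟨l, hhead, hlast, hnodup, hchain⟩ := exists_nodup_isChain_of_reflTransGen hreach
  refine ⟨l, ?_, hhead, hlast, hnodup, hchain.rel_of_mem_zip_tail⟩
  match l, hhead, hlast with
  | [a], hhead, hlast =>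
    simp only [List.head?_cons, List.getLast?_singleton, Option.some.injEq] at hhead hlast
    exact absurd (hhead.symm.trans hlast) hxt
  | _ :: _ :: _, _, _ => simp
end
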